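/- arXiv:2504.06048 — 4 statements merged into one kernel-verified Lean document; each statement's English description precedes it below -/
import Mathlib

section
/- (Lemma A.2 / Theorem 2.1, improvement part) Let π be a full-support prior policy and let q be any policy satisfying q_t(s,a) > 0 → π_t(s,a) > 0 for all t, s, a. Then J(q) ≥ L(q) and L(π) = J(π); consequently, if L(q) ≥ L(π) (in particular if q maximizes L over all such policies), then J(q) ≥ J(π), i.e. the KL-regularized optimal policy provides a policy improvement in the unregularized MDP. -/
/-- Probability of a trajectory `x` (index `i : Fin T` represents time `i+1`, so times run
over `1,…,T`) under initial distribution `p₁`, transition kernel `P` and policy `q`: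
`p_q(h) = p₁(s₁) · ∏_{t=1}^T q_t(s_t,a_t) · ∏_{t=2}^T P(s_{t−1},a_{t−1},s_t)`. -/
noncomputable def pTraj {S A : Type} (T : ℕ) (p₁ : S → ℝ) (P : S → A → S → ℝ)
    (q : ℕ → S → A → ℝ) (x : Fin T → S × A) : ℝ :=
  (if h0 : 0 < T then p₁ (x ⟨0, h0⟩).1 else 1) *
    (∏ i : Fin T, q (i.1 + 1) (x i).1 (x i).2) *
    ∏ i : Fin T, if hlt : i.1 + 1 < T then P (x i).1 (x i).2 (x ⟨i.1 + 1, hlt⟩).1 else 1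

/-- Return of a trajectory: `R(h) = ∑_{t=1}^T R(s_t,a_t)`. -/
noncomputable def ret {S A : Type} (T : ℕ) (R : S → A → ℝ) (x : Fin T → S × A) : ℝ :=
  ∑ i : Fin T, R (x i).1 (x i).2

/-- Value of a policy: `J(q) = ∑_h p_q(h)·R(h)`. -/
noncomputable def Jval {S A : Type} [Fintype S] [Fintype A] (T : ℕ) (p₁ : S → ℝ) (P : S → A → S → ℝ)
    (R : S → A → ℝ) (q : ℕ → S → A → ℝ) : ℝ :=
  ∑ x : Fin T → S × A, pTraj T p₁ P q x * ret T R x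

/-- KL-regularized objective of `q` relative to the prior `π`:
`L(q) = ∑_{h : p_q(h)>0} p_q(h)·(R(h) + ∑_{t=1}^T log(π_t(s_t,a_t)/q_t(s_t,a_t)))`. -/
noncomputable def Lval {S A : Type} [Fintype S] [Fintype A] (T : ℕ) (p₁ : S → ℝ) (P : S → A → S → ℝ)
    (R : S → A → ℝ) (π q : ℕ → S → A → ℝ) : ℝ :=
  ∑ x : Fin T → S × A,
    if 0 < pTraj T p₁ P q x then
      pTraj T p₁ P q x * (ret T R x +
        ∑ i : Fin T,
          Real.log (π (i.1 + 1) (x i).1 (x i).2 / q (i.1 + 1) (x i).1 (x i).2))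
    else 0

/-- `q` is a (nonstationary) policy for times `1,…,T`. -/
def IsPolicy {S A : Type} [Fintype A] (T : ℕ) (q : ℕ → S → A → ℝ) : Prop :=
  ∀ t ∈ Finset.Icc 1 T, ∀ s : S, (∀ a : A, 0 ≤ q t s a) ∧ (∑ a : A, q t s a) = 1

/-- `π` has full support: `π_t(s,a) > 0` for all `t,s,a`. -/
def FullSupport {S A : Type} (T : ℕ) (π : ℕ → S → A → ℝ) : Prop :=
  ∀ t ∈ Finset.Icc 1 T, ∀ (s : S) (a : A), 0 < π t s a

/-- `q` is absolutely continuous w.r.t. `π`: `q_t(s,a) > 0 → π_t(s,a) > 0`. -/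
def AbsCont {S A : Type} (T : ℕ) (q π : ℕ → S → A → ℝ) : Prop :=
  ∀ t ∈ Finset.Icc 1 T, ∀ (s : S) (a : A), 0 < q t s a → 0 < π t s a

/-- KL divergence on a finite type: `KL(u‖v) = ∑_{x : u(x)>0} u(x)·log(u(x)/v(x))`. -/
noncomputable def KL {X : Type} [Fintype X] (u v : X → ℝ) : ℝ :=
  ∑ x : X, if 0 < u x then u x * Real.log (u x / v x) else 0

theorem pTraj_cons {S A : Type} (T : ℕ) (p₁ : S → ℝ) (P : S → A → S → ℝ)
    (q : ℕ → S → A → ℝ) (z : S × A) (y : Fin T → S × A) :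
    pTraj (T + 1) p₁ P q (Fin.cons z y : Fin (T + 1) → S × A) =
      p₁ z.1 * q 1 z.1 z.2 * pTraj T (P z.1 z.2) P (fun t => q (t + 1)) y := by
  have hstep (i : Fin T) (h : i.1 + 1 + 1 < T + 1) :
      (Fin.cons z y : Fin (T + 1) → S × A) ⟨i.1 + 1 + 1, h⟩ =
        y ⟨i.1 + 1, Nat.lt_of_succ_lt_succ h⟩ := rfl
  have hone (h : 0 + 1 < T + 1) :
      (Fin.cons z y : Fin (T + 1) → S × A) ⟨0 + 1, h⟩ =
        y ⟨0, Nat.lt_of_succ_lt_succ h⟩ := rfl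
  have hzero (h : 0 < T + 1) : (Fin.cons z y : Fin (T + 1) → S × A) ⟨0, h⟩ = z := rfl
  unfold pTraj
  simp only [Fin.prod_univ_succ, Fin.cons_zero, Fin.cons_succ, Fin.val_zero, Fin.val_succ,
    hstep, hone, hzero, Nat.add_lt_add_iff_right, Nat.zero_add, Nat.succ_pos, dite_true]
  ring

theorem sum_pTraj {S A : Type} [Fintype S] [Fintype A] (T : ℕ) (p₁ : S → ℝ)
    (hp₁sum : ∑ s, p₁ s = 1) (P : S → A → S → ℝ) (hPsum : ∀ s a, ∑ s', P s a s' = 1)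
    (q : ℕ → S → A → ℝ) (hq : ∀ t ∈ Finset.Icc 1 T, ∀ s, ∑ a, q t s a = 1) :
    ∑ x : Fin T → S × A, pTraj T p₁ P q x = 1 := by
  induction T generalizing p₁ q with
  | zero => simp [pTraj]
  | succ T ih =>
    have hq' : ∀ t ∈ Finset.Icc 1 T, ∀ s, ∑ a, q (t + 1) s a = 1 := fun t ht =>
      hq (t + 1) (by simp only [Finset.mem_Icc] at *; omega)
    rw [← (Fin.consEquiv fun _ => S × A).sum_comp, Fintype.sum_prod_type]
    change ∑ z : S × A, ∑ y : Fin T → S × A,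
      pTraj (T + 1) p₁ P q (Fin.cons z y : Fin (T + 1) → S × A) = 1
    simp only [pTraj_cons, ← Finset.mul_sum]
    simp only [ih _ (hPsum _ _) _ hq', mul_one, Fintype.sum_prod_type, ← Finset.mul_sum,
      hq 1 (by simp), hp₁sum]

theorem pTraj_nonneg {S A : Type} [Fintype A] (T : ℕ) (p₁ : S → ℝ) (hp₁ : ∀ s, 0 ≤ p₁ s)
    (P : S → A → S → ℝ) (hP : ∀ s a s', 0 ≤ P s a s') (q : ℕ → S → A → ℝ)
    (hq : IsPolicy T q) (x : Fin T → S × A) : 0 ≤ pTraj T p₁ P q x := by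
  unfold pTraj
  refine mul_nonneg (mul_nonneg ?_ (Finset.prod_nonneg fun i _ => ?_))
    (Finset.prod_nonneg fun i _ => ?_)
  · split_ifs
    exacts [hp₁ _, zero_le_one]
  · exact (hq _ (by simp only [Finset.mem_Icc]; omega) _).1 _
  · split_ifs
    exacts [hP _ _ _, zero_le_one]

theorem pTraj_mul_sum_log_le {S A : Type} [Fintype A] (T : ℕ) (p₁ : S → ℝ)
    (P : S → A → S → ℝ) (π q : ℕ → S → A → ℝ) (hq : IsPolicy T q) (hqac : AbsCont T q π)
    (x : Fin T → S × A) (hx : 0 < pTraj T p₁ P q x) :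
    pTraj T p₁ P q x * ∑ i : Fin T,
        Real.log (π (i.1 + 1) (x i).1 (x i).2 / q (i.1 + 1) (x i).1 (x i).2) ≤
      pTraj T p₁ P π x - pTraj T p₁ P q x := by
  have hmem (i : Fin T) : i.1 + 1 ∈ Finset.Icc 1 T := by
    simp only [Finset.mem_Icc]; omega
  have hprod : ∏ i : Fin T, q (i.1 + 1) (x i).1 (x i).2 ≠ 0 :=
    right_ne_zero_of_mul (left_ne_zero_of_mul hx.ne')
  have hqpos (i : Fin T) : 0 < q (i.1 + 1) (x i).1 (x i).2 :=
    ((hq _ (hmem i) _).1 _).lt_of_ne' (Finset.prod_ne_zero_iff.mp hprod i (Finset.mem_univ i))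
  have hratio (i : Fin T) : 0 < π (i.1 + 1) (x i).1 (x i).2 / q (i.1 + 1) (x i).1 (x i).2 :=
    div_pos (hqac _ (hmem i) _ _ (hqpos i)) (hqpos i)
  have hlog := Real.log_le_sub_one_of_pos (Finset.prod_pos fun i (_ : i ∈ Finset.univ) => hratio i)
  rw [Real.log_prod fun i _ => (hratio i).ne'] at hlog
  refine (mul_le_mul_of_nonneg_left hlog hx.le).trans_eq ?_
  rw [mul_sub, mul_one, Finset.prod_div_distrib]
  congr 1
  unfold pTraj
  field_simp

theorem Lval_le_Jval {S A : Type} [Fintype S] [Fintype A] (T : ℕ)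
    (p₁ : S → ℝ) (hp₁ : ∀ s, 0 ≤ p₁ s) (hp₁sum : ∑ s, p₁ s = 1)
    (P : S → A → S → ℝ) (hP : ∀ s a s', 0 ≤ P s a s') (hPsum : ∀ s a, ∑ s', P s a s' = 1)
    (R : S → A → ℝ) (π q : ℕ → S → A → ℝ) (hπ : IsPolicy T π) (hq : IsPolicy T q)
    (hqac : AbsCont T q π) : Lval T p₁ P R π q ≤ Jval T p₁ P R q := by
  have hbound : Lval T p₁ P R π q ≤ ∑ x : Fin T → S × A,
      (pTraj T p₁ P q x * ret T R x + (pTraj T p₁ P π x - pTraj T p₁ P q x)) := by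
    refine Finset.sum_le_sum fun x _ => ?_
    split_ifs with hx
    · rw [mul_add]
      gcongr
      exact pTraj_mul_sum_log_le T p₁ P π q hq hqac x hx
    · rw [le_antisymm (not_lt.mp hx) (pTraj_nonneg T p₁ hp₁ P hP q hq x)]
      simpa using pTraj_nonneg T p₁ hp₁ P hP π hπ x
  rwa [Finset.sum_add_distrib, Finset.sum_sub_distrib,
    sum_pTraj T p₁ hp₁sum P hPsum π fun t ht s => (hπ t ht s).2,
    sum_pTraj T p₁ hp₁sum P hPsum q fun t ht s => (hq t ht s).2, sub_self, add_zero] at hbound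

theorem Lval_self {S A : Type} [Fintype S] [Fintype A] (T : ℕ)
    (p₁ : S → ℝ) (hp₁ : ∀ s, 0 ≤ p₁ s) (P : S → A → S → ℝ) (hP : ∀ s a s', 0 ≤ P s a s')
    (R : S → A → ℝ) (π : ℕ → S → A → ℝ) (hπ : IsPolicy T π) :
    Lval T p₁ P R π π = Jval T p₁ P R π := by
  have hlog (y : ℝ) : Real.log (y / y) = 0 := by
    by_cases hy : y = 0 <;> simp [hy]
  refine Finset.sum_congr rfl fun x _ => ?_
  split_ifs with hx
  · simp [hlog]
  · rw [le_antisymm (not_lt.mp hx) (pTraj_nonneg T p₁ hp₁ P hP π hπ x), zero_mul]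

/-- Lemma A.2 / Theorem 2.1, improvement part:
`J(q) ≥ L(q)`, `L(π) = J(π)`, and hence `L(q) ≥ L(π) → J(q) ≥ J(π)`. -/
theorem stmt_0 {S A : Type} [Fintype S] [Fintype A] [Nonempty S] [Nonempty A]
    (T : ℕ) (hT : 1 ≤ T)
    (p₁ : S → ℝ) (hp₁ : ∀ s, 0 ≤ p₁ s) (hp₁sum : (∑ s : S, p₁ s) = 1)
    (P : S → A → S → ℝ) (hP : ∀ s a s', 0 ≤ P s a s')
    (hPsum : ∀ s a, (∑ s' : S, P s a s') = 1)
    (R : S → A → ℝ)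
    (π : ℕ → S → A → ℝ) (hπ : IsPolicy T π) (hπpos : FullSupport T π)
    (q : ℕ → S → A → ℝ) (hq : IsPolicy T q) (hqac : AbsCont T q π) :
    Lval T p₁ P R π q ≤ Jval T p₁ P R q ∧
      Lval T p₁ P R π π = Jval T p₁ P R π ∧
      (Lval T p₁ P R π π ≤ Lval T p₁ P R π q → Jval T p₁ P R π ≤ Jval T p₁ P R q) := by
  have hle := Lval_le_Jval T p₁ hp₁ hp₁sum P hP hPsum R π q hπ hq hqac
  have hself := Lval_self T p₁ hp₁ P hP R π hπ
  exact ⟨hle, hself, fun h => hself ▸ h.trans hle⟩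
end

section
/- (Soft-Bellman recursion, Eq. 3) For every 1 ≤ t ≤ T and (s,a), the exponentiated soft Q-value equals the expected exponentiated return-to-go under the prior policy π started from (s,a) at time t: exp Q_t(s,a) = Σ over suffixes (s_{t+1},a_{t+1},…,s_T,a_T) of [ Π_{j=t+1}^{T} P(s_{j−1},a_{j−1},s_j)·π_j(s_j,a_j) ] · exp( Σ_{j=t}^{T} R(s_j,a_j) ), with the convention s_t = s, a_t = a (for t = T the right-hand side is exp R(s,a)). -/
/-- Weight of the length-`n` suffix `g` following `(s,a)` at time `t`: its probability under
`P` and `π` times the exponentiated return-to-go. -/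
noncomputable def suffixWeight {S A : Type} (P : S → A → S → ℝ) (R : S → A → ℝ)
    (π : ℕ → S → A → ℝ) (n t : ℕ) (s : S) (a : A) (g : Fin n → S × A) : ℝ :=
  ((if h0 : 0 < n then P s a (g ⟨0, h0⟩).1 else 1) *
      ∏ j : Fin n,
        ((if hj : j.1 + 1 < n then P (g j).1 (g j).2 (g ⟨j.1 + 1, hj⟩).1 else 1) *
          π (t + 1 + j.1) (g j).1 (g j).2)) *
    Real.exp (R s a + ∑ j : Fin n, R (g j).1 (g j).2)

theorem suffixWeight_zero {S A : Type} (P : S → A → S → ℝ) (R : S → A → ℝ)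
    (π : ℕ → S → A → ℝ) (t : ℕ) (s : S) (a : A) (g : Fin 0 → S × A) :
    suffixWeight P R π 0 t s a g = Real.exp (R s a) := by
  simp [suffixWeight]

theorem suffixWeight_cons {S A : Type} (P : S → A → S → ℝ) (R : S → A → ℝ)
    (π : ℕ → S → A → ℝ) (n t : ℕ) (s : S) (a : A) (p : S × A) (g : Fin n → S × A) :
    suffixWeight P R π (n + 1) t s a (Fin.cons p g : Fin (n + 1) → S × A) =
      Real.exp (R s a) * (P s a p.1 * (π (t + 1) p.1 p.2 *
        suffixWeight P R π n (t + 1) p.1 p.2 g)) := by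
  have hshift : ∀ (i : ℕ) (hi : i + 1 < n + 1),
      (Fin.cons p g : Fin (n + 1) → S × A) ⟨i + 1, hi⟩ = g ⟨i, Nat.lt_of_succ_lt_succ hi⟩ :=
    fun _ _ ↦ rfl
  have hzero : (Fin.cons p g : Fin (n + 1) → S × A) ⟨0, n.succ_pos⟩ = p := rfl
  have htime : ∀ j : Fin n, t + 1 + (j.1 + 1) = t + 1 + 1 + j.1 := fun j ↦ by omega
  unfold suffixWeight
  rw [Fin.prod_univ_succ, Fin.sum_univ_succ]
  simp only [Fin.cons_zero, Fin.cons_succ, Fin.val_zero, Fin.val_succ, hshift, hzero, htime,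
    Nat.succ_pos, dite_true, Nat.add_lt_add_iff_right, Real.exp_add, add_zero]
  ring

theorem sum_suffixWeight_succ {S A : Type} [Fintype S] [Fintype A] (P : S → A → S → ℝ)
    (R : S → A → ℝ) (π : ℕ → S → A → ℝ) (n t : ℕ) (s : S) (a : A) :
    ∑ g : Fin (n + 1) → S × A, suffixWeight P R π (n + 1) t s a g =
      Real.exp (R s a) * ∑ s' : S, P s a s' * ∑ b : A, π (t + 1) s' b *
        ∑ g : Fin n → S × A, suffixWeight P R π n (t + 1) s' b g := by
  rw [← (Fin.consEquiv fun _ : Fin (n + 1) ↦ S × A).sum_comp, Fintype.sum_prod_type,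
    Fintype.sum_prod_type]
  simp only [Finset.mul_sum]
  exact Finset.sum_congr rfl fun x _ ↦ Finset.sum_congr rfl fun b _ ↦
    Finset.sum_congr rfl fun g _ ↦ suffixWeight_cons P R π n t s a (x, b) g

theorem sum_mul_exp_pos {X : Type} [Fintype X] {w : X → ℝ} (hw : ∀ x, 0 ≤ w x)
    (hsum : ∑ x, w x = 1) (f : X → ℝ) : 0 < ∑ x, w x * Real.exp (f x) := by
  obtain ⟨x, hx, hne⟩ := Finset.exists_ne_zero_of_sum_ne_zero (hsum.trans_ne one_ne_zero)
  exact Finset.sum_pos' (fun y _ ↦ mul_nonneg (hw y) (Real.exp_pos _).le)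
    ⟨x, hx, mul_pos ((hw x).lt_of_ne' hne) (Real.exp_pos _)⟩

/-- Soft-Bellman recursion, Eq. 3: for `1 ≤ t ≤ T`,
`exp Q_t(s,a)` equals the expected exponentiated return-to-go under the prior `π`
started from `(s,a)` at time `t`; a suffix `g : Fin (T−t) → S × A` lists
`(s_{t+1},a_{t+1},…,s_T,a_T)` (index `j` is time `t+1+j`). -/
theorem stmt_3 {S A : Type} [Fintype S] [Fintype A] [Nonempty S] [Nonempty A]
    (T : ℕ) (hT : 1 ≤ T)
    (P : S → A → S → ℝ) (hP : ∀ s a s', 0 ≤ P s a s')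
    (hPsum : ∀ s a, (∑ s' : S, P s a s') = 1)
    (R : S → A → ℝ)
    (π : ℕ → S → A → ℝ) (hπ : IsPolicy T π) (hπpos : FullSupport T π)
    (V : ℕ → S → ℝ) (Q : ℕ → S → A → ℝ)
    (hVT : ∀ s, V (T + 1) s = 0)
    (hQ : ∀ t ∈ Finset.Icc 1 T, ∀ (s : S) (a : A),
      Q t s a = R s a + Real.log (∑ s' : S, P s a s' * Real.exp (V (t + 1) s')))
    (hV : ∀ t ∈ Finset.Icc 1 T, ∀ s : S,
      V t s = Real.log (∑ a : A, π t s a * Real.exp (Q t s a)))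
    (t : ℕ) (ht1 : 1 ≤ t) (ht2 : t ≤ T) (s : S) (a : A) :
    Real.exp (Q t s a) =
      ∑ g : Fin (T - t) → S × A,
        ((if h0 : 0 < T - t then P s a (g ⟨0, h0⟩).1 else 1) *
            ∏ j : Fin (T - t),
              ((if hj : j.1 + 1 < T - t then P (g j).1 (g j).2 (g ⟨j.1 + 1, hj⟩).1 else 1) *
                π (t + 1 + j.1) (g j).1 (g j).2)) *
          Real.exp (R s a + ∑ j : Fin (T - t), R (g j).1 (g j).2) := by
  have hexpQ : ∀ t ∈ Finset.Icc 1 T, ∀ s a, Real.exp (Q t s a) =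
      Real.exp (R s a) * ∑ s' : S, P s a s' * Real.exp (V (t + 1) s') := fun t ht s a ↦ by
    rw [hQ t ht, Real.exp_add, Real.exp_log (sum_mul_exp_pos (hP s a) (hPsum s a) _)]
  have hexpV : ∀ t ∈ Finset.Icc 1 T, ∀ s, Real.exp (V t s) =
      ∑ a : A, π t s a * Real.exp (Q t s a) := fun t ht s ↦ by
    rw [hV t ht, Real.exp_log (sum_mul_exp_pos (hπ t ht s).1 (hπ t ht s).2 _)]
  have key : ∀ n t, 1 ≤ t → t + n = T → ∀ s a,
      Real.exp (Q t s a) = ∑ g : Fin n → S × A, suffixWeight P R π n t s a g := by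
    intro n
    induction n with
    | zero =>
      rintro t ht rfl s a
      rw [hexpQ t (Finset.mem_Icc.2 ⟨ht, le_rfl⟩)]
      simp only [add_zero] at hVT
      simp [hVT, hPsum, suffixWeight_zero]
    | succ n ih =>
      intro t ht htn s a
      rw [hexpQ t (Finset.mem_Icc.2 ⟨ht, by omega⟩), sum_suffixWeight_succ]
      simp only [hexpV (t + 1) (Finset.mem_Icc.2 ⟨by omega, by omega⟩),
        ih (t + 1) (by omega) (by omega)]
  exact key (T - t) t ht1 (by omega) s a
end

section
/- (Corollary 2.2, sequential importance sampling weight recursion) Let q be a proposal policy with q_j(s,a) > 0 → π_j(s,a) > 0 for all j, s, a. For 1 ≤ t ≤ T define the partial-trajectory distributions p^post_{1:t}(s_1,a_1,…,s_t,a_t) = p₁(s_1)·Π_{j=1}^{t} q^post_j(s_j,a_j)·Π_{j=2}^{t} P(s_{j−1},a_{j−1},s_j) (target: posterior policies with the true dynamics) and p^q_{1:t} defined analogously with q in place of q^post. Then for every partial trajectory (s_1,a_1,…,s_t,a_t) with p^q_{1:t} > 0: p^post_{1:t} / p^q_{1:t} = Π_{j=1}^{t} [ π_j(s_j,a_j)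 / q_j(s_j,a_j) ] · exp(R(s_j,a_j)) · [ Σ_{s'} P(s_j,a_j,s')·exp V_{j+1}(s') ] / exp V_j(s_j), i.e. the importance weights satisfy w_t = w_{t−1} · (π/q) · exp(R_t) · E[exp V_{t+1}] / exp V_t. -/
/-- The initial distribution and the dynamics cancel in a ratio of trajectory probabilities. -/
theorem pTraj_div_pTraj {S A : Type} {T : ℕ} {p₁ : S → ℝ} {P : S → A → S → ℝ}
    (q' : ℕ → S → A → ℝ) {q : ℕ → S → A → ℝ} {x : Fin T → S × A} (hx : pTraj T p₁ P q x ≠ 0) :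
    pTraj T p₁ P q' x / pTraj T p₁ P q x =
      ∏ i : Fin T, q' (i.1 + 1) (x i).1 (x i).2 / q (i.1 + 1) (x i).1 (x i).2 := by
  unfold pTraj at hx ⊢
  rw [mul_ne_zero_iff, mul_ne_zero_iff] at hx
  obtain ⟨⟨hinit, -⟩, hdyn⟩ := hx
  rw [mul_div_mul_right _ _ hdyn, mul_div_mul_left _ _ hinit, Finset.prod_div_distrib]

/-- The expectation of a positive function under a probability vector is positive. -/
theorem sum_mul_pos_of_sum_eq_one {ι : Type*} [Fintype ι] {w f : ι → ℝ} (hw : ∀ i, 0 ≤ w i)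
    (hsum : ∑ i, w i = 1) (hf : ∀ i, 0 < f i) : 0 < ∑ i, w i * f i := by
  obtain ⟨i, -, hi⟩ := Finset.exists_ne_zero_of_sum_ne_zero (hsum ▸ one_ne_zero : ∑ i, w i ≠ 0)
  exact Finset.sum_pos' (fun j _ => mul_nonneg (hw j) (hf j).le)
    ⟨i, Finset.mem_univ i, mul_pos ((hw i).lt_of_ne' hi) (hf i)⟩

/-- Corollary 2.2, sequential importance sampling weight recursion: for a
partial trajectory `g` of length `t` (times `1,…,t`; index `j` is time `j+1`) with positive
proposal probability, the ratio of the posterior-policy partial-trajectory distribution to the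
proposal one is the product over steps of
`(π/q)·exp(R)·(∑_{s'} P(·,·,s')·exp V_{j+1}(s')) / exp V_j(s_j)`. -/
theorem stmt_10 {S A : Type} [Fintype S] [Fintype A] [Nonempty S] [Nonempty A]
    (T : ℕ) (hT : 1 ≤ T)
    (p₁ : S → ℝ) (hp₁ : ∀ s, 0 ≤ p₁ s) (hp₁sum : (∑ s : S, p₁ s) = 1)
    (P : S → A → S → ℝ) (hP : ∀ s a s', 0 ≤ P s a s')
    (hPsum : ∀ s a, (∑ s' : S, P s a s') = 1)
    (R : S → A → ℝ)
    (π : ℕ → S → A → ℝ) (hπ : IsPolicy T π) (hπpos : FullSupport T π)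
    (V : ℕ → S → ℝ) (Q : ℕ → S → A → ℝ)
    (hVT : ∀ s, V (T + 1) s = 0)
    (hQ : ∀ t ∈ Finset.Icc 1 T, ∀ (s : S) (a : A),
      Q t s a = R s a + Real.log (∑ s' : S, P s a s' * Real.exp (V (t + 1) s')))
    (hV : ∀ t ∈ Finset.Icc 1 T, ∀ s : S,
      V t s = Real.log (∑ a : A, π t s a * Real.exp (Q t s a)))
    (q : ℕ → S → A → ℝ) (hq : IsPolicy T q) (hqac : AbsCont T q π)
    (t : ℕ) (ht1 : 1 ≤ t) (ht2 : t ≤ T)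
    (g : Fin t → S × A)
    (hpos : 0 < pTraj t p₁ P q g) :
    pTraj t p₁ P (fun j s a => π j s a * Real.exp (Q j s a - V j s)) g /
        pTraj t p₁ P q g =
      ∏ j : Fin t,
        (π (j.1 + 1) (g j).1 (g j).2 / q (j.1 + 1) (g j).1 (g j).2) *
          Real.exp (R (g j).1 (g j).2) *
          ((∑ s' : S, P (g j).1 (g j).2 s' * Real.exp (V (j.1 + 2) s')) /
            Real.exp (V (j.1 + 1) (g j).1)) := by
  rw [pTraj_div_pTraj _ hpos.ne']
  refine Finset.prod_congr rfl fun j _ => ?_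
  have hj : j.1 + 1 ∈ Finset.Icc 1 T := Finset.mem_Icc.mpr ⟨by omega, by omega⟩
  rw [Real.exp_sub, hQ _ hj, Real.exp_add, Real.exp_log
    (sum_mul_pos_of_sum_eq_one (hP _ _) (hPsum _ _) fun _ => Real.exp_pos _)]
  ring
end

section
/- (Monotonicity of the KL divergence of the tilted family; correctness of the bisection search for the trust-region temperature) Let X be a finite nonempty type, p : X → ℝ with p(x) > 0 for all x and Σ_x p(x) = 1, and f : X → ℝ. Then the map β ↦ KL(q_β ‖ p) is nondecreasing on [0,∞), and KL(q_0 ‖ p) = 0. -/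
/-- Exponentially tilted distribution `q_β(x) = p(x)·exp(β·f(x)) / ∑_y p(y)·exp(β·f(y))`. -/
noncomputable def qtilt {X : Type} [Fintype X] (p f : X → ℝ) (β : ℝ) (x : X) : ℝ :=
  p x * Real.exp (β * f x) / ∑ y : X, p y * Real.exp (β * f y)

section Tilted

variable {X : Type} [Fintype X] [Nonempty X] {p : X → ℝ}

theorem tilted_normalizer_pos (hp : ∀ x, 0 < p x) (f : X → ℝ) (β : ℝ) :
    0 < ∑ y, p y * Real.exp (β * f y) :=
  Finset.sum_pos (fun y _ => mul_pos (hp y) (Real.exp_pos _)) Finset.univ_nonempty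

theorem qtilt_pos (hp : ∀ x, 0 < p x) (f : X → ℝ) (β : ℝ) (x : X) : 0 < qtilt p f β x :=
  div_pos (mul_pos (hp x) (Real.exp_pos _)) (tilted_normalizer_pos hp f β)

theorem sum_qtilt (hp : ∀ x, 0 < p x) (f : X → ℝ) (β : ℝ) : ∑ x, qtilt p f β x = 1 := by
  simp only [qtilt, ← Finset.sum_div]
  exact div_self (ne_of_gt (tilted_normalizer_pos hp f β))

/-- The divergence of the tilted distribution is `β` times its mean of `f`, minus the
log-normalizer. -/
theorem KL_qtilt (hp : ∀ x, 0 < p x) (f : X → ℝ) (β : ℝ) :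
    KL (qtilt p f β) p =
      β * ∑ x, qtilt p f β x * f x - Real.log (∑ y, p y * Real.exp (β * f y)) := by
  have hZ := tilted_normalizer_pos hp f β
  have hlog (x : X) : Real.log (qtilt p f β x / p x) =
      β * f x - Real.log (∑ y, p y * Real.exp (β * f y)) := by
    rw [qtilt, div_right_comm, mul_div_cancel_left₀ _ (hp x).ne',
      Real.log_div (Real.exp_ne_zero _) hZ.ne', Real.log_exp]
  simp only [KL, qtilt_pos hp f β, if_true, hlog, mul_sub, Finset.sum_sub_distrib]
  rw [← Finset.sum_mul, sum_qtilt hp, one_mul, Finset.mul_sum]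
  simp only [mul_left_comm]

/-- The log-normalizer lies above its tangent lines, whose slopes are the tilted means. -/
theorem mul_mean_le_log_normalizer_sub (hp : ∀ x, 0 < p x) (f : X → ℝ) (a b : ℝ) :
    (b - a) * ∑ x, qtilt p f a x * f x ≤
      Real.log (∑ y, p y * Real.exp (b * f y)) - Real.log (∑ y, p y * Real.exp (a * f y)) := by
  have hZa := tilted_normalizer_pos hp f a
  have hZb := tilted_normalizer_pos hp f b
  have hjensen := convexOn_exp.map_sum_le (t := Finset.univ) (w := qtilt p f a)
    (p := fun x => (b - a) * f x) (fun x _ => (qtilt_pos hp f a x).le) (sum_qtilt hp f a)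
    (fun _ _ => Set.mem_univ _)
  have hratio : ∑ x, qtilt p f a x • Real.exp ((b - a) * f x) =
      (∑ y, p y * Real.exp (b * f y)) / ∑ y, p y * Real.exp (a * f y) := by
    rw [Finset.sum_div]
    refine Finset.sum_congr rfl fun x _ => ?_
    rw [smul_eq_mul, qtilt, div_mul_eq_mul_div, mul_assoc, ← Real.exp_add]
    ring_nf
  rw [← Real.log_div hZb.ne' hZa.ne', Real.le_log_iff_exp_le (div_pos hZb hZa), ← hratio,
    Finset.mul_sum]
  simpa only [smul_eq_mul, mul_left_comm] using hjensen

theorem KL_qtilt_le (hp : ∀ x, 0 < p x) (f : X → ℝ) {a b : ℝ} (ha : 0 ≤ a) (hab : a ≤ b) :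
    KL (qtilt p f a) p ≤ KL (qtilt p f b) p := by
  obtain rfl | hlt := hab.eq_or_lt
  · rfl
  have h₁ := mul_mean_le_log_normalizer_sub hp f a b
  have h₂ := mul_mean_le_log_normalizer_sub hp f b a
  have hmean : ∑ x, qtilt p f a x * f x ≤ ∑ x, qtilt p f b x * f x :=
    le_of_mul_le_mul_left (by linarith) (sub_pos.2 hlt)
  rw [KL_qtilt hp, KL_qtilt hp]
  linarith [mul_le_mul_of_nonneg_left hmean ha]

end Tilted

/-- Monotonicity of the KL divergence of the tilted family: the map
`β ↦ KL(q_β ‖ p)` is nondecreasing on `[0,∞)` and `KL(q_0 ‖ p) = 0`. -/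
theorem stmt_13 {X : Type} [Fintype X] [Nonempty X]
    (p : X → ℝ) (hp : ∀ x, 0 < p x) (hpsum : (∑ x : X, p x) = 1)
    (f : X → ℝ) :
    (∀ β₁ β₂ : ℝ, 0 ≤ β₁ → β₁ ≤ β₂ → KL (qtilt p f β₁) p ≤ KL (qtilt p f β₂) p) ∧
      KL (qtilt p f 0) p = 0 := by
  refine ⟨fun _ _ h₀ hle => KL_qtilt_le hp f h₀ hle, ?_⟩
  simp [KL_qtilt hp, hpsum]
end
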